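/- arXiv:2109.12432 — 8 statements merged into one kernel-verified Lean document; each statement's English description precedes it below -/
import Mathlib

section
/- For every m ≥ 1, the number of alpha-words w : Fin m → {a,b,c} with w 0 = a, w (m−1) = c, and such that for each i < m−1, w i has a down edge iff w (i+1) has an up edge, equals the Fibonacci number F_{m−1} (with F_0 = 0, F_1 = 1); the same count F_{m−1} is obtained for words w : Fin m → {b,d,f} with w 0 = d, w (m−1) = f satisfying the same adjacent-letter condition. (These are the cardinalities of the sets F_m of admissible first columns and L_m of admissible last columns of the code matrix of a 2-factor of a rectangular grid graph.) -/
/-- The six alpha-letters, recording which two of the four directions are used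
at a grid vertex by a 2-factor: `a` = down&right, `b` = up&down, `c` = up&right,
`d` = down&left, `e` = left&right, `f` = up&left. -/
inductive Alpha : Type
  | a | b | c | d | e | f
  deriving DecidableEq

/-- The letter has a right edge iff it lies in `{a, c, e}`. -/
def Alpha.right : Alpha → Bool
  | .a => true
  | .c => true
  | .e => true
  | _ => false

/-- The letter has a left edge iff it lies in `{d, e, f}`. -/
def Alpha.left : Alpha → Bool
  | .d => true
  | .e => true
  | .f => true
  | _ => false

/-- The letter has a down edge iff it lies in `{a, b, d}`. -/
def Alpha.down : Alpha → Bool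
  | .a => true
  | .b => true
  | .d => true
  | _ => false

/-- The letter has an up edge iff it lies in `{b, c, f}`. -/
def Alpha.up : Alpha → Bool
  | .b => true
  | .c => true
  | .f => true
  | _ => false

/-- Membership in the vertex set `V(D_m)` of the digraph `D_m`: consecutive letters are
compatible (`w i` has a down edge iff `w (i+1)` has an up edge), the first letter has no
up edge, and the last letter has no down edge. -/
def InVD {m : ℕ} (w : Fin m → Alpha) : Prop :=
  (∀ i j : Fin m, (j : ℕ) = (i : ℕ) + 1 → (w i).down = (w j).up) ∧
  (∀ i : Fin m, (i : ℕ) = 0 → (w i).up = false) ∧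
  (∀ i : Fin m, (i : ℕ) = m - 1 → (w i).down = false)

/-- The arc relation of the digraph `D_m`: `v → u` iff both are vertices of `D_m` and for
every `i`, `v i` has a right edge iff `u i` has a left edge. -/
def DArc {m : ℕ} (v u : Fin m → Alpha) : Prop :=
  InVD v ∧ InVD u ∧ ∀ i, (v i).right = (u i).left

/-- The outlet word of an alpha-word: `o(w) i = true` iff `w i` has a right edge. -/
def outlet {m : ℕ} (w : Fin m → Alpha) : Fin m → Bool :=
  fun i => (w i).right

/-- Membership in the vertex set `V(D*_m)` of the transfer digraph `D*_m`: the binary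
words realized as outlet words of vertices of `D_m`. -/
def InVDStar {m : ℕ} (p : Fin m → Bool) : Prop :=
  ∃ w : Fin m → Alpha, InVD w ∧ outlet w = p

/-- The arc relation of the transfer digraph `D*_m`: `p → q` iff there are vertices
`v, u` of `D_m` with outlet words `p, q` and an arc `v → u` in `D_m`. -/
def DStarArc {m : ℕ} (p q : Fin m → Bool) : Prop :=
  ∃ v u : Fin m → Alpha, outlet v = p ∧ outlet u = q ∧ DArc v u

instance : Finite Alpha :=
  Finite.of_injective (fun x : Alpha => (x.right, x.left, x.down, x.up)) <| by
    intro x y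
    cases x <;> cases y <;> decide

/-- The linked words of length `n + 1` over the letters `p`, `q`, `r` that start with `s` and
end with `r`. -/
def columnWords (p q r s : Alpha) (n : ℕ) : Set (Fin (n + 1) → Alpha) :=
  {w | (∀ i, w i = p ∨ w i = q ∨ w i = r) ∧ w 0 = s ∧ w (Fin.last n) = r ∧
    ∀ i : Fin n, (w i.castSucc).down = (w i.succ).up}

section

variable {p q r s : Alpha}

theorem cons_mem_columnWords (hs : s = p ∨ s = q ∨ s = r) {n : ℕ} {x : Alpha}
    {w : Fin (n + 1) → Alpha} :
    (Fin.cons x w : Fin (n + 2) → Alpha) ∈ columnWords p q r s (n + 1) ↔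
      x = s ∧ s.down = (w 0).up ∧ w ∈ columnWords p q r (w 0) n := by
  simp only [columnWords, Set.mem_ofPred_eq, Fin.forall_fin_succ (n := n + 1), Fin.cons_zero,
    Fin.cons_succ, ← Fin.succ_last, Fin.forall_fin_succ (n := n), Fin.castSucc_zero,
    ← Fin.succ_castSucc]
  constructor
  · rintro ⟨⟨-, h⟩, rfl, hr, hd, hl⟩
    exact ⟨rfl, hd, h, trivial, hr, hl⟩
  · rintro ⟨rfl, hd, h, -, hr, hl⟩
    exact ⟨⟨hs, h⟩, rfl, hr, hd, hl⟩

theorem columnWords_succ (hs : s = p ∨ s = q ∨ s = r) (n : ℕ) :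
    columnWords p q r s (n + 1) = (Fin.cons s : _ → Fin (n + 2) → Alpha) ''
      {w | s.down = (w 0).up ∧ w ∈ columnWords p q r (w 0) n} := by
  ext w
  rw [← Fin.cons_self_tail w, cons_mem_columnWords hs]
  simp only [Set.mem_image, Set.mem_ofPred_eq, Fin.cons_inj]
  constructor
  · rintro ⟨h, hw⟩
    exact ⟨_, hw, h.symm, rfl⟩
  · rintro ⟨v, hv, h, rfl⟩
    exact ⟨h.symm, hv⟩

theorem ncard_columnWords_succ_of_down (hs : s = p ∨ s = q ∨ s = r) (hsd : s.down = true)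
    (hp : p.up = false) (hq : q.up = true) (hr : r.up = true) (hqr : q ≠ r) (n : ℕ) :
    (columnWords p q r s (n + 1)).ncard =
      (columnWords p q r q n).ncard + (columnWords p q r r n).ncard := by
  rw [columnWords_succ hs, Set.ncard_image_of_injective _
      (Fin.cons_right_injective (α := fun _ => Alpha) s),
    ← Set.ncard_union_eq _ (Set.toFinite _) (Set.toFinite _)]
  · congr 1
    ext w
    simp only [columnWords, Set.mem_ofPred_eq, Set.mem_union, hsd]
    constructor
    · rintro ⟨hd, h, -, h'⟩
      rcases h 0 with h0 | h0 | h0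
      · simp [h0, hp] at hd
      · exact .inl ⟨h, h0, h'⟩
      · exact .inr ⟨h, h0, h'⟩
    · rintro (⟨h, h0, h'⟩ | ⟨h, h0, h'⟩)
      · exact ⟨by rw [h0, hq], h, trivial, h'⟩
      · exact ⟨by rw [h0, hr], h, trivial, h'⟩
  · exact Set.disjoint_left.2 fun w h h' => hqr (h.2.1.symm.trans h'.2.1)

theorem ncard_columnWords_succ_of_not_down (hs : s = p ∨ s = q ∨ s = r) (hsd : s.down = false)
    (hp : p.up = false) (hq : q.up = true) (hr : r.up = true) (n : ℕ) :
    (columnWords p q r s (n + 1)).ncard = (columnWords p q r p n).ncard := by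
  rw [columnWords_succ hs, Set.ncard_image_of_injective _
      (Fin.cons_right_injective (α := fun _ => Alpha) s)]
  congr 1
  ext w
  simp only [columnWords, Set.mem_ofPred_eq, hsd]
  constructor
  · rintro ⟨hd, h, -, h'⟩
    rcases h 0 with h0 | h0 | h0
    · exact ⟨h, h0, h'⟩
    · simp [h0, hq] at hd
    · simp [h0, hr] at hd
  · rintro ⟨h, h0, h'⟩
    exact ⟨by rw [h0, hp], h, trivial, h'⟩

theorem columnWords_zero_of_ne (hsr : s ≠ r) : columnWords p q r s 0 = ∅ :=
  Set.eq_empty_of_forall_notMem fun _ h => hsr (h.2.1.symm.trans h.2.2.1)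

theorem columnWords_zero_self : columnWords p q r r 0 = {fun _ => r} := by
  ext w
  simp only [columnWords, Set.mem_ofPred_eq, Set.mem_singleton_iff]
  constructor
  · rintro ⟨-, h, -⟩
    ext i
    rw [Fin.fin_one_eq_zero i, h]
  · rintro rfl
    simp

theorem ncard_columnWords (hp : p.up = false) (hpd : p.down = true) (hq : q.up = true)
    (hqd : q.down = true) (hr : r.up = true) (hrd : r.down = false) (n : ℕ) :
    (columnWords p q r p n).ncard = n.fib ∧ (columnWords p q r q n).ncard = n.fib ∧
      (columnWords p q r r (n + 1)).ncard = n.fib := by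
  have hqr : q ≠ r := by rintro rfl; simp [hqd] at hrd
  have hpr : p ≠ r := by rintro rfl; simp [hpd] at hrd
  have hrs := ncard_columnWords_succ_of_not_down (s := r) (by simp) hrd hp hq hr
  have hps := ncard_columnWords_succ_of_down (s := p) (by simp) hpd hp hq hr hqr
  have hqs := ncard_columnWords_succ_of_down (s := q) (by simp) hqd hp hq hr hqr
  rw [hrs]
  suffices h : (columnWords p q r p n).ncard = n.fib ∧ (columnWords p q r q n).ncard = n.fib from
    ⟨h.1, h.2, h.1⟩
  induction n using Nat.twoStepInduction with
  | zero => simp [columnWords_zero_of_ne hpr, columnWords_zero_of_ne hqr]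
  | one => simp [hps, hqs, columnWords_zero_of_ne hqr, columnWords_zero_self]
  | more n ih ih' =>
    rw [hps (n + 1), hqs (n + 1), hrs, ih.1, ih'.2, Nat.fib_add_two, add_comm]
    exact ⟨rfl, rfl⟩

theorem mem_columnWords_iff {n : ℕ} {w : Fin (n + 1) → Alpha} :
    w ∈ columnWords p q r s n ↔ (∀ i, w i = p ∨ w i = q ∨ w i = r) ∧
      (∀ i : Fin (n + 1), (i : ℕ) = 0 → w i = s) ∧
      (∀ i : Fin (n + 1), (i : ℕ) = n + 1 - 1 → w i = r) ∧
      (∀ i j : Fin (n + 1), (j : ℕ) = (i : ℕ) + 1 → (w i).down = (w j).up) := by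
  refine and_congr_right fun _ => and_congr ?_ (and_congr ?_ ?_)
  · refine ⟨fun h i hi => ?_, fun h => h 0 rfl⟩
    rwa [show i = 0 from Fin.ext hi]
  · refine ⟨fun h i hi => ?_, fun h => h _ rfl⟩
    rwa [show i = Fin.last n from Fin.ext hi]
  · refine ⟨fun h i j hij => ?_, fun h i => h _ _ rfl⟩
    have hi : (i : ℕ) < n := by omega
    rw [show j = Fin.succ ⟨i, hi⟩ from Fin.ext hij]
    exact h ⟨i, hi⟩

end

/-- The sets `F_m` of admissible first columns and `L_m` of admissible last columns of the
code matrix of a 2-factor of a rectangular grid graph both have cardinality the Fibonacci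
number `F_{m-1}`. -/
theorem first_last_column_count (m : ℕ) (hm : 1 ≤ m) :
    Nat.card {w : Fin m → Alpha //
      (∀ i, w i = Alpha.a ∨ w i = Alpha.b ∨ w i = Alpha.c) ∧
      (∀ i : Fin m, (i : ℕ) = 0 → w i = Alpha.a) ∧
      (∀ i : Fin m, (i : ℕ) = m - 1 → w i = Alpha.c) ∧
      (∀ i j : Fin m, (j : ℕ) = (i : ℕ) + 1 → (w i).down = (w j).up)} = Nat.fib (m - 1) ∧
    Nat.card {w : Fin m → Alpha //
      (∀ i, w i = Alpha.b ∨ w i = Alpha.d ∨ w i = Alpha.f) ∧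
      (∀ i : Fin m, (i : ℕ) = 0 → w i = Alpha.d) ∧
      (∀ i : Fin m, (i : ℕ) = m - 1 → w i = Alpha.f) ∧
      (∀ i j : Fin m, (j : ℕ) = (i : ℕ) + 1 → (w i).down = (w j).up)} = Nat.fib (m - 1) := by
  obtain ⟨n, rfl⟩ := Nat.exists_eq_add_of_le' hm
  constructor
  · simp only [← mem_columnWords_iff]
    exact (ncard_columnWords rfl rfl rfl rfl rfl rfl n).1
  · simp only [or_left_comm (a := _ = Alpha.b), ← mem_columnWords_iff]
    exact (ncard_columnWords rfl rfl rfl rfl rfl rfl n).1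
end

section
/- For every m ≥ 1, the number of vertices of the digraph D_m satisfies 2 · |V(D_m)| = 3^m + (−1)^m. -/
instance Alpha.instFintype : Fintype Alpha where
  elems := {.a, .b, .c, .d, .e, .f}
  complete x := by cases x <;> decide

/-- Words in which consecutive letters are compatible, the first letter has an up edge iff `s`,
and the last letter has no down edge. The empty word qualifies iff `s` is `false`. -/
def IsColumn : {m : ℕ} → Bool → (Fin m → Alpha) → Prop
  | 0, s, _ => s = false
  | _ + 1, s, w => (w 0).up = s ∧ IsColumn (w 0).down (Fin.tail w)

theorem isColumn_succ_iff {n : ℕ} (s : Bool) (w : Fin (n + 1) → Alpha) :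
    IsColumn s w ↔ (w 0).up = s ∧
      (∀ i : Fin n, (w i.castSucc).down = (w i.succ).up) ∧ (w (Fin.last n)).down = false := by
  induction n generalizing s with
  | zero => simp [IsColumn]
  | succ n ih =>
    rw [IsColumn, ih, Fin.forall_fin_succ]
    simp only [Fin.tail, Fin.castSucc_zero, Fin.succ_castSucc, Fin.succ_last]
    grind

theorem inVD_iff_isColumn {n : ℕ} (w : Fin (n + 1) → Alpha) : InVD w ↔ IsColumn false w := by
  rw [isColumn_succ_iff]
  constructor
  · rintro ⟨hchain, hfirst, hlast⟩
    exact ⟨hfirst 0 rfl, fun i => hchain _ _ (by simp), hlast _ (by simp)⟩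
  · rintro ⟨hfirst, hchain, hlast⟩
    refine ⟨fun i j hij => ?_, fun i hi => ?_, fun i hi => ?_⟩
    · have hi : (i : ℕ) < n := by lia
      obtain rfl : j = Fin.succ ⟨i, hi⟩ := Fin.ext hij
      exact hchain ⟨i, hi⟩
    · obtain rfl : i = 0 := Fin.ext hi
      exact hfirst
    · obtain rfl : i = Fin.last n := Fin.ext hi
      exact hlast

theorem card_isColumn_succ (m : ℕ) (s : Bool) :
    Nat.card {w : Fin (m + 1) → Alpha // IsColumn s w} =
      ∑ x : Alpha, if x.up = s then Nat.card {w : Fin m → Alpha // IsColumn x.down w} else 0 := by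
  let e : {w : Fin (m + 1) → Alpha // IsColumn s w} ≃
      Σ x : Alpha, {w : Fin m → Alpha // x.up = s ∧ IsColumn x.down w} :=
    { toFun := fun w => ⟨w.1 0, Fin.tail w.1, w.2⟩
      invFun := fun p => ⟨Fin.cons p.1 p.2.1, by simpa [IsColumn] using p.2.2⟩
      left_inv := fun w => Subtype.ext (Fin.cons_self_tail w.1)
      right_inv := fun _ => rfl }
  rw [Nat.card_congr e, Nat.card_sigma]
  refine Finset.sum_congr rfl fun x _ => ?_
  by_cases hx : x.up = s <;> simp [hx]

theorem two_mul_card_isColumn (m : ℕ) (s : Bool) :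
    (2 : ℤ) * Nat.card {w : Fin m → Alpha // IsColumn s w} =
      3 ^ m + (if s then -1 else 1) * (-1) ^ m := by
  induction m generalizing s with
  | zero => cases s <;> simp [IsColumn]
  | succ m ih =>
    have hf := ih false
    have ht := ih true
    have huniv : (Finset.univ : Finset Alpha) = {.a, .b, .c, .d, .e, .f} := rfl
    rw [card_isColumn_succ, huniv]
    cases s <;> simp [Alpha.up, Alpha.down, pow_succ] at hf ht ⊢ <;> linarith

/-- The number of vertices of the digraph `D_m` satisfies `2 ⬝ |V(D_m)| = 3^m + (-1)^m`. -/
theorem card_VD (m : ℕ) (hm : 1 ≤ m) :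
    (2 : ℤ) * Nat.card {w : Fin m → Alpha // InVD w} = 3 ^ m + (-1) ^ m := by
  obtain ⟨n, rfl⟩ := Nat.exists_eq_add_of_le' hm
  rw [Nat.card_congr (Equiv.subtypeEquivRight inVD_iff_isColumn), two_mul_card_isColumn]
  simp
end

section
/- For every m ≥ 2, the digraph D_m is disconnected — there exist vertices v, w ∈ V(D_m) not joined by any walk in the symmetrization of the arc relation — and each of its components is strongly connected: for all v, w ∈ V(D_m), if w is reachable from v by a directed walk then v is reachable from w by a directed walk. -/
/-- The mirror image of a letter, exchanging left and right. -/
def Alpha.mirror : Alpha → Alpha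
  | .a => .d
  | .b => .b
  | .c => .f
  | .d => .a
  | .e => .e
  | .f => .c

@[simp] theorem Alpha.left_mirror (x : Alpha) : x.mirror.left = x.right := by cases x <;> rfl
@[simp] theorem Alpha.right_mirror (x : Alpha) : x.mirror.right = x.left := by cases x <;> rfl
@[simp] theorem Alpha.up_mirror (x : Alpha) : x.mirror.up = x.up := by cases x <;> rfl
@[simp] theorem Alpha.down_mirror (x : Alpha) : x.mirror.down = x.down := by cases x <;> rfl

theorem InVD.mirror {m : ℕ} {w : Fin m → Alpha} (h : InVD w) : InVD fun i => (w i).mirror := by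
  simpa [InVD] using h

/-- Every arc `v → u` lies on a closed walk, returning through the mirror images of `u`
and `v`. -/
theorem DArc.reachable_symm {m : ℕ} {v u : Fin m → Alpha} (h : DArc v u) :
    Relation.ReflTransGen DArc u v := by
  obtain ⟨hv, hu, hvu⟩ := h
  have h₁ : DArc u fun i => (u i).mirror := ⟨hu, hu.mirror, by simp⟩
  have h₂ : DArc (fun i => (u i).mirror) fun i => (v i).mirror :=
    ⟨hu.mirror, hv.mirror, by simp [hvu]⟩
  have h₃ : DArc (fun i => (v i).mirror) v := ⟨hv.mirror, hv, by simp⟩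
  exact ((Relation.ReflTransGen.single h₁).tail h₂).tail h₃

/-- The alternating sum of the positions where a binary word vanishes. -/
def altDefect {m : ℕ} (p : Fin m → Bool) : ℤ :=
  ∑ i : Fin m, (-1) ^ (i : ℕ) * (1 - ((p i).toNat : ℤ))

theorem Alpha.defect_add_defect (x : Alpha) :
    (1 - (x.left.toNat : ℤ)) + (1 - (x.right.toNat : ℤ)) = x.down.toNat + x.up.toNat := by
  cases x <;> rfl

/-- In an alternating sum over a column, each vertical edge is counted twice, with
opposite signs. -/
theorem InVD.alternating_vertical {m : ℕ} {w : Fin m → Alpha} (h : InVD w) :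
    ∑ i : Fin m, (-1 : ℤ) ^ (i : ℕ) * ((w i).down.toNat + (w i).up.toNat : ℤ) = 0 := by
  obtain ⟨h₁, h₂, h₃⟩ := h
  cases m with
  | zero => simp
  | succ n =>
    simp only [mul_add, Finset.sum_add_distrib]
    rw [Fin.sum_univ_castSucc, Fin.sum_univ_succ (fun i => (-1 : ℤ) ^ (i : ℕ) * ((w i).up.toNat : ℤ)),
      h₂ 0 rfl, h₃ (Fin.last n) rfl]
    simp [h₁ (Fin.castSucc _) (Fin.succ _) rfl, pow_succ]

theorem InVD.altDefect_add {m : ℕ} {w : Fin m → Alpha} (h : InVD w) :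
    altDefect (fun i => (w i).left) + altDefect (outlet w) = 0 := by
  rw [← h.alternating_vertical]
  simp only [altDefect, outlet, ← Finset.sum_add_distrib, ← mul_add, Alpha.defect_add_defect]

theorem DArc.altDefect_outlet {m : ℕ} {v u : Fin m → Alpha} (h : DArc v u) :
    altDefect (outlet u) = -altDefect (outlet v) := by
  have h' : outlet v = fun i => (u i).left := funext h.2.2
  rw [h']
  linarith [h.2.1.altDefect_add]

theorem altDefect_outlet_eq_zero_of_reachable {m : ℕ} {v w : Fin m → Alpha}
    (h : Relation.ReflTransGen (fun x y => DArc x y ∨ DArc y x) v w)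
    (hv : altDefect (outlet v) = 0) : altDefect (outlet w) = 0 := by
  induction h with
  | refl => exact hv
  | tail _ h ih =>
    rcases h with h | h
    · rw [h.altDefect_outlet, ih, neg_zero]
    · rw [h.altDefect_outlet] at ih
      exact neg_eq_zero.mp ih

/-- For `m ≥ 2`, the digraph `D_m` is disconnected, and each of its components is
strongly connected. -/
theorem D_disconnected_strong_components (m : ℕ) (hm : 2 ≤ m) :
    (∃ v w : Fin m → Alpha, InVD v ∧ InVD w ∧
      ¬ Relation.ReflTransGen (fun x y => DArc x y ∨ DArc y x) v w) ∧
    (∀ v w : Fin m → Alpha, InVD v → InVD w →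
      Relation.ReflTransGen DArc v w → Relation.ReflTransGen DArc w v) := by
  refine ⟨⟨fun _ => .e, fun i => if (i : ℕ) = 0 then .a else if (i : ℕ) = 1 then .f else .e,
    ?_, ?_, fun h => ?_⟩, fun v w hv hw h => ?_⟩
  · simp [InVD, Alpha.up, Alpha.down]
  · refine ⟨fun i j hij => ?_, fun i hi => ?_, fun i hi => ?_⟩ <;> dsimp only <;> split_ifs <;>
      first | rfl | omega
  · have h0 := altDefect_outlet_eq_zero_of_reachable h (by simp [altDefect, outlet, Alpha.right])
    obtain ⟨n, rfl⟩ := Nat.exists_eq_add_of_le' hm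
    simp [altDefect, outlet, Fin.sum_univ_succ, Alpha.right] at h0
  · clear hv hw
    induction h with
    | refl => exact .refl
    | tail _ h ih => exact h.reachable_symm.trans ih
end

section
/- For every m ≥ 2, the vertices e^m (the constant alpha-word with every letter e) and db^{m−2}f (the alpha-word with first letter d, last letter f, and all intermediate letters b) are mutually reachable in the digraph D_m if and only if m is even. (That is, the component A_m of D_m containing e^m coincides with the component R_m containing db^{m−2}f iff m is even.) -/
/-- The alternating sum of a binary word. -/
def alternatingSum {m : ℕ} (p : Fin m → Bool) : ℤ :=
  ∑ i : Fin m, (-1) ^ (i : ℕ) * ((p i).toNat : ℤ)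

theorem Alpha.left_add_right_add_up_add_down (x : Alpha) :
    (x.left.toNat : ℤ) + x.right.toNat = 2 - (x.up.toNat + x.down.toNat) := by
  cases x <;> decide

/-- The up edges and the down edges of a vertex of `D_m` are the same edges, seen from
their two ends, so their contributions to the alternating sum cancel. -/
theorem InVD.alternatingSum_up_add_down {m : ℕ} {w : Fin m → Alpha} (h : InVD w) :
    alternatingSum (fun i => (w i).up) + alternatingSum (fun i => (w i).down) = 0 := by
  obtain ⟨hadj, hfirst, hlast⟩ := h
  cases m with
  | zero => simp [alternatingSum]
  | succ n =>
    have hup : (w 0).up = false := hfirst 0 rfl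
    have hdown : (w (Fin.last n)).down = false := hlast _ (by simp)
    have hsucc (i : Fin n) : (w i.succ).up = (w i.castSucc).down :=
      (hadj i.castSucc i.succ (by simp)).symm
    unfold alternatingSum
    rw [Fin.sum_univ_succ, Fin.sum_univ_castSucc (n := n)]
    simp [hup, hdown, hsucc, pow_succ]

theorem InVD.alternatingSum_left_add_right {m : ℕ} {w : Fin m → Alpha} (hm : Odd m)
    (h : InVD w) :
    alternatingSum (fun i => (w i).left) + alternatingSum (outlet w) = 2 := by
  have hvert := h.alternatingSum_up_add_down
  have hone : ∑ i : Fin m, (-1 : ℤ) ^ (i : ℕ) = 1 := by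
    rw [Fin.sum_neg_one_pow, if_neg (Nat.not_even_iff_odd.mpr hm)]
  have hsum : alternatingSum (fun i => (w i).left) + alternatingSum (outlet w) =
      2 * ∑ i : Fin m, (-1 : ℤ) ^ (i : ℕ) -
        (alternatingSum (fun i => (w i).up) + alternatingSum (fun i => (w i).down)) := by
    simp only [alternatingSum, outlet, Finset.mul_sum, ← Finset.sum_add_distrib,
      ← Finset.sum_sub_distrib]
    refine Finset.sum_congr rfl fun i _ => ?_
    linear_combination (-1 : ℤ) ^ (i : ℕ) * (w i).left_add_right_add_up_add_down
  rw [hsum, hone, hvert]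
  norm_num

theorem alternatingSum_outlet_eq_one_of_reachable {m : ℕ} (hm : Odd m)
    {v u : Fin m → Alpha} (hv : alternatingSum (outlet v) = 1)
    (h : Relation.ReflTransGen DArc v u) : alternatingSum (outlet u) = 1 := by
  induction h with
  | refl => exact hv
  | @tail x y _ hxy ih =>
    have hy := hxy.2.1.alternatingSum_left_add_right hm
    have hleft : (fun i => (y i).left) = outlet x := funext fun i => (hxy.2.2 i).symm
    rw [hleft, ih] at hy
    linarith

/-- The alpha-word `x y ⋯ y z`. -/
def capWord (m : ℕ) (x y z : Alpha) : Fin m → Alpha :=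
  fun i => if (i : ℕ) = 0 then x else if (i : ℕ) = m - 1 then z else y

/-- The alpha-word `x y x y ⋯`. -/
def alternatingWord (m : ℕ) (x y : Alpha) : Fin m → Alpha :=
  fun i => if Even (i : ℕ) then x else y

theorem inVD_const_e (m : ℕ) : InVD (fun _ : Fin m => Alpha.e) :=
  ⟨fun _ _ _ => rfl, fun _ _ => rfl, fun _ _ => rfl⟩

theorem inVD_capWord {m : ℕ} (hm : 2 ≤ m) {x z : Alpha} (hxu : x.up = false)
    (hxd : x.down = true) (hzu : z.up = true) (hzd : z.down = false) :
    InVD (capWord m x .b z) := by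
  refine ⟨fun i j hij => ?_, fun i hi => ?_, fun i hi => ?_⟩
  · have hi : (i : ℕ) ≠ m - 1 := by omega
    have hj : (j : ℕ) ≠ 0 := by omega
    simp only [capWord, hi, hj, if_false]
    have hbu : Alpha.b.up = true := rfl
    have hbd : Alpha.b.down = true := rfl
    split_ifs <;> simp only [hxd, hzu, hbu, hbd]
  · simp [capWord, hi, hxu]
  · have hi0 : (i : ℕ) ≠ 0 := by omega
    simp only [capWord, hi0, if_false, if_pos hi, hzd]

theorem inVD_alternatingWord {m : ℕ} (hm : Even m) {x y : Alpha} (hxu : x.up = false)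
    (hxd : x.down = true) (hyu : y.up = true) (hyd : y.down = false) :
    InVD (alternatingWord m x y) := by
  refine ⟨fun i j hij => ?_, fun i hi => ?_, fun i hi => ?_⟩
  · by_cases hi : Even (i : ℕ) <;>
      simp [alternatingWord, hij, Nat.even_add_one, hi, hxu, hxd, hyu, hyd]
  · simp [alternatingWord, hi, hxu]
  · have hi' : ¬ Even (i : ℕ) := by
      have := i.isLt
      grind
    simp [alternatingWord, hi', hyd]

/-- For `m ≥ 2`, the vertices `e^m` and `d b^{m-2} f` of `D_m` are mutually reachable iff
`m` is even. -/
theorem e_dbf_mutually_reachable_iff (m : ℕ) (hm : 2 ≤ m) :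
    (Relation.ReflTransGen DArc (fun _ : Fin m => Alpha.e)
        (fun i : Fin m => if (i : ℕ) = 0 then Alpha.d else
          if (i : ℕ) = m - 1 then Alpha.f else Alpha.b) ∧
     Relation.ReflTransGen DArc
        (fun i : Fin m => if (i : ℕ) = 0 then Alpha.d else
          if (i : ℕ) = m - 1 then Alpha.f else Alpha.b)
        (fun _ : Fin m => Alpha.e)) ↔ Even m := by
  change (Relation.ReflTransGen DArc _ (capWord m .d .b .f) ∧
    Relation.ReflTransGen DArc (capWord m .d .b .f) _) ↔ _
  constructor
  · rintro ⟨h, -⟩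
    by_contra hodd
    rw [Nat.not_even_iff_odd] at hodd
    have he : alternatingSum (outlet fun _ : Fin m => Alpha.e) = 1 := by
      have := (inVD_const_e m).alternatingSum_left_add_right hodd
      change alternatingSum (outlet fun _ : Fin m => Alpha.e) + _ = 2 at this
      linarith
    have hdbf : outlet (capWord m .d .b .f) = fun _ => false := by
      funext i
      simp only [outlet, capWord]
      split_ifs <;> rfl
    have := alternatingSum_outlet_eq_one_of_reachable hodd he h
    simp [hdbf, alternatingSum] at this
  · intro heven
    have he := inVD_const_e m
    have hdf : InVD (alternatingWord m .d .f) := inVD_alternatingWord heven rfl rfl rfl rfl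
    have hac : InVD (alternatingWord m .a .c) := inVD_alternatingWord heven rfl rfl rfl rfl
    have habc : InVD (capWord m .a .b .c) := inVD_capWord hm rfl rfl rfl rfl
    have hdbf : InVD (capWord m .d .b .f) := inVD_capWord hm rfl rfl rfl rfl
    constructor
    · refine .head (b := alternatingWord m .d .f) ⟨he, hdf, fun i => ?_⟩ <|
        .head (b := capWord m .a .b .c) ⟨hdf, habc, fun i => ?_⟩ <|
        .single ⟨habc, hdbf, fun i => ?_⟩ <;>
      · simp only [alternatingWord, capWord]
        split_ifs <;> rfl
    · refine .head (b := alternatingWord m .a .c) ⟨hdbf, hac, fun i => ?_⟩ <|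
        .single ⟨hac, he, fun i => ?_⟩ <;>
      · simp only [alternatingWord, capWord]
        split_ifs <;> rfl
end

section
/- For every m ≥ 1 and all binary words p, q : Fin m → Bool, there is an arc p → q in the transfer digraph D*_m if and only if there is an arc q → p; that is, the 0/1 adjacency (transfer) matrix T*_m of D*_m is a symmetric matrix. -/
theorem DStarArc.symm {m : ℕ} {p q : Fin m → Bool} (h : DStarArc p q) : DStarArc q p := by
  obtain ⟨v, u, rfl, rfl, -, hu, hvu⟩ := h
  refine ⟨u, fun i => (u i).mirror, rfl, ?_, hu, hu.mirror, fun i => by simp⟩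
  funext i
  simp [outlet, hvu i]

/-- The arc relation of the transfer digraph `D*_m` is symmetric; that is, the transfer
matrix `T*_m` is a symmetric matrix. -/
theorem DStarArc_symm (m : ℕ) (hm : 1 ≤ m) (p q : Fin m → Bool) :
    DStarArc p q ↔ DStarArc q p :=
  ⟨DStarArc.symm, DStarArc.symm⟩
end

section
/- For every m ≥ 1, the number of vertices of the transfer digraph D*_m equals 2^m if m is even, and 2^m − 1 if m is odd. (For odd m, the unique binary word of length m not realized as an outlet word is 0101…010.) -/
/-- The letter with prescribed up, down and right edges; junk if all three bits agree. -/
def Alpha.ofEdges : Bool → Bool → Bool → Alpha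
  | false, false, _ => .e
  | false, true, true => .a
  | false, true, false => .d
  | true, false, true => .c
  | true, false, false => .f
  | true, true, _ => .b

theorem Alpha.ofEdges_spec (s t r : Bool) (h : ¬(s = t ∧ t = r)) :
    (ofEdges s t r).up = s ∧ (ofEdges s t r).down = t ∧ (ofEdges s t r).right = r := by
  revert s t r
  decide

theorem Alpha.not_edges_eq (x : Alpha) : ¬(x.up = x.down ∧ x.down = x.right) := by
  cases x <;> decide

/-- `s` lists the vertical edges along the first `n` letters of a column with outlets `p`,
starting without an up edge. -/
def IsVertical (p : ℕ → Bool) (n : ℕ) (s : ℕ → Bool) : Prop :=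
  s 0 = false ∧ ∀ i < n, ¬(s i = s (i + 1) ∧ s (i + 1) = p i)

theorem inVDStar_iff {m : ℕ} (hm : 1 ≤ m) (p : ℕ → Bool) :
    InVDStar (fun i : Fin m => p i) ↔ ∃ s, IsVertical p m s ∧ s m = false := by
  constructor
  · rintro ⟨w, ⟨h, h0, h1⟩, hw⟩
    refine ⟨fun i => if hi : i < m then (w ⟨i, hi⟩).up else false, ⟨?_, ?_⟩, by simp⟩
    · simp only [show 0 < m from hm, dite_true]
      exact h0 _ rfl
    · intro i hi
      have hr : (w ⟨i, hi⟩).right = p i := congrFun hw ⟨i, hi⟩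
      have hd : (w ⟨i, hi⟩).down = if hi : i + 1 < m then (w ⟨i + 1, hi⟩).up else false := by
        split_ifs with hlt
        · exact h _ _ rfl
        · exact h1 _ (by simp only; omega)
      simp only [hi, dite_true, ← hr, ← hd]
      exact Alpha.not_edges_eq _
  · rintro ⟨s, ⟨h0, h⟩, h1⟩
    have key (i : Fin m) := Alpha.ofEdges_spec _ _ _ (h i i.2)
    refine ⟨fun i => Alpha.ofEdges (s i) (s (i + 1)) (p i), ⟨?_, ?_, ?_⟩, ?_⟩
    · intro i j hij
      rw [(key i).2.1, (key j).1, hij]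
    · intro i hi
      rw [(key i).1, hi, h0]
    · intro i hi
      rw [(key i).2.1, hi, Nat.sub_add_cancel hm, h1]
    · funext i
      exact (key i).2.2

/-- The parity sequence `0, 1, 0, 1, …`. -/
def alternating (i : ℕ) : Bool := decide (Odd i)

theorem alternating_succ (i : ℕ) : alternating (i + 1) = !alternating i := by
  simp only [alternating, Nat.odd_add_one, decide_not]

theorem isVertical_alternating (p : ℕ → Bool) (n : ℕ) : IsVertical p n alternating :=
  ⟨by simp [alternating], fun i _ => by rw [alternating_succ]; simp⟩

theorem IsVertical.eq_alternating {p s : ℕ → Bool} {n : ℕ} (hs : IsVertical p n s)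
    (hp : ∀ i < n, p i = alternating i) : ∀ i ≤ n, s i = alternating i := by
  intro i
  induction i with
  | zero => simp [hs.1, alternating]
  | succ i ih =>
    intro hi
    have h := hs.2 i hi
    rw [ih (by omega), hp i hi] at h
    rw [alternating_succ]
    revert h
    cases s (i + 1) <;> cases alternating i <;> simp

theorem IsVertical.extend {p s : ℕ → Bool} {n : ℕ} (hs : IsVertical p n s) {t : Bool}
    (ht : ¬(s n = t ∧ t = p n)) : ∃ s', IsVertical p (n + 1) s' ∧ s' (n + 1) = t := by
  refine ⟨Function.update s (n + 1) t, ⟨by simp [hs.1, Function.update], ?_⟩, by simp⟩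
  intro i hi
  rcases Nat.lt_succ_iff_lt_or_eq.mp hi with h | rfl
  · rw [Function.update_of_ne (by omega), Function.update_of_ne (by omega)]
    exact hs.2 i h
  · rwa [Function.update_of_ne (by omega), Function.update_self]

theorem alternating_or_forall_exists_isVertical (p : ℕ → Bool) (n : ℕ) :
    (∀ i < n, p i = alternating i) ∨ ∀ t, ∃ s, IsVertical p n s ∧ s n = t := by
  induction n with
  | zero => left; simp
  | succ n ih =>
    rcases ih with h | h
    · by_cases hn : p n = alternating n
      · left
        intro i hi
        rcases Nat.lt_succ_iff_lt_or_eq.mp hi with h' | rfl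
        exacts [h i h', hn]
      · right
        intro t
        exact (isVertical_alternating p n).extend fun h' => hn (h'.2.symm.trans h'.1.symm)
    · right
      intro t
      obtain ⟨s, hs, hst⟩ := h (!t)
      exact hs.extend (by simp [hst])

theorem inVDStar_iff_even_or_ne_alternating {m : ℕ} (hm : 1 ≤ m) (p : Fin m → Bool) :
    InVDStar p ↔ (Even m ∨ p ≠ fun i : Fin m => alternating i) := by
  obtain ⟨q, rfl⟩ : ∃ q : ℕ → Bool, p = fun i : Fin m => q i :=
    ⟨fun i => if hi : i < m then p ⟨i, hi⟩ else false, by funext i; simp⟩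
  rw [inVDStar_iff hm]
  constructor
  · rintro ⟨s, hs, hsm⟩
    by_contra! hc
    have h := hs.eq_alternating (fun i hi => congrFun hc.2 ⟨i, hi⟩) m le_rfl
    simp [hsm, alternating] at h
    exact Nat.not_even_iff_odd.mpr (by simpa using hc.1) h
  · intro h
    rcases alternating_or_forall_exists_isVertical q m with ha | ha
    · rcases h with h | h
      · exact ⟨_, isVertical_alternating q m, by simpa [alternating] using h⟩
      · exact absurd (funext fun i : Fin m => ha i i.2) h
    · exact ha false

/-- The number of vertices of the transfer digraph `D*_m` equals `2^m` if `m` is even and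
`2^m - 1` if `m` is odd. -/
theorem card_VDStar (m : ℕ) (hm : 1 ≤ m) :
    Nat.card {p : Fin m → Bool // InVDStar p} =
      if Even m then 2 ^ m else 2 ^ m - 1 := by
  simp only [inVDStar_iff_even_or_ne_alternating hm]
  split_ifs with h
  · simp [h]
  · simp only [h, false_or]
    rw [Nat.card_eq_fintype_card, Fintype.card_subtype_compl, Fintype.card_subtype_eq]
    simp
end

section
/- For every m ≥ 1, the subdigraph of the transfer digraph D*_m induced by the set of vertices having an odd number of coordinates equal to false (an odd number of 0's) is bipartite: every directed closed walk in D*_m all of whose vertices have an odd number of 0's has even length. -/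
/-- The alternating sum `∑ (-1)^i` over the coordinates `i` at which the word `p` is `false`. -/
def altZeros {m : ℕ} (p : Fin m → Bool) : ℤ :=
  ∑ i : Fin m, (-1) ^ (i : ℕ) * (if p i = false then 1 else 0)

/-- Every letter uses exactly two directions: the number of horizontal directions it misses
is the number of vertical directions it uses. -/
lemma Alpha.horizontal_missing_eq_vertical (x : Alpha) :
    ((if x.left = false then 1 else 0) + (if x.right = false then 1 else 0) : ℤ) =
      (if x.up then 1 else 0) + (if x.down then 1 else 0) := by
  cases x <;> simp [Alpha.left, Alpha.right, Alpha.up, Alpha.down]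

/-- The alternating sum of the vertical degrees along a column vanishes. -/
lemma InVD.sum_vertical_eq_zero {m : ℕ} {w : Fin m → Alpha} (hw : InVD w) :
    ∑ i : Fin m, (-1 : ℤ) ^ (i : ℕ) *
      ((if (w i).up then 1 else 0) + (if (w i).down then 1 else 0)) = 0 := by
  obtain ⟨hcompat, hfirst, hlast⟩ := hw
  let z : ℕ → ℤ := fun k => if h : k < m then (if (w ⟨k, h⟩).up then 1 else 0) else 0
  have hup : ∀ i : Fin m, (if (w i).up then 1 else 0 : ℤ) = z i := fun i => by simp [z]
  have hdown : ∀ i : Fin m, (if (w i).down then 1 else 0 : ℤ) = z (i + 1) := fun i => by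
    by_cases h : (i : ℕ) + 1 < m
    · simp [z, h, hcompat i ⟨i + 1, h⟩ rfl]
    · simp [z, h, hlast i (by omega)]
  have hz_first : z 0 = 0 := by
    by_cases h : 0 < m
    · simp [z, h, hfirst ⟨0, h⟩ rfl]
    · simp [z, h]
  have hz_last : z m = 0 := by simp [z]
  calc _ = ∑ i : Fin m, ((-1 : ℤ) ^ (i : ℕ) * z i - (-1) ^ ((i : ℕ) + 1) * z (i + 1)) :=
        Finset.sum_congr rfl fun i _ => by rw [hup, hdown]; ring
    _ = ∑ k ∈ Finset.range m, ((-1 : ℤ) ^ k * z k - (-1) ^ (k + 1) * z (k + 1)) :=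
        Fin.sum_univ_eq_sum_range (fun k => (-1 : ℤ) ^ k * z k - (-1) ^ (k + 1) * z (k + 1)) m
    _ = 0 := by rw [Finset.sum_range_sub' (fun k => (-1 : ℤ) ^ k * z k)]; simp [hz_first, hz_last]

/-- Arcs of the transfer digraph negate the alternating sum of zeros. -/
lemma DStarArc.altZeros_eq_neg {m : ℕ} {p q : Fin m → Bool} (h : DStarArc p q) :
    altZeros q = -altZeros p := by
  obtain ⟨v, u, rfl, rfl, -, hu, hvu⟩ := h
  rw [eq_neg_iff_add_eq_zero, add_comm, ← hu.sum_vertical_eq_zero, altZeros, altZeros,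
    ← Finset.sum_add_distrib]
  refine Finset.sum_congr rfl fun i _ => ?_
  rw [← Alpha.horizontal_missing_eq_vertical, ← mul_add, outlet, outlet, hvu]

/-- A word with an odd number of zeros has a nonzero alternating sum of zeros. -/
lemma altZeros_ne_zero {m : ℕ} {p : Fin m → Bool}
    (hp : Odd (Finset.univ.filter (fun i : Fin m => p i = false)).card) : altZeros p ≠ 0 := by
  intro h
  have hmod : ((altZeros p : ℤ) : ZMod 2) =
      ((Finset.univ.filter (fun i : Fin m => p i = false)).card : ZMod 2) := by
    simp [altZeros]
  rw [h, ZMod.natCast_eq_one_iff_odd.mpr hp] at hmod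
  simp at hmod

/-- The subdigraph of `D*_m` induced by the vertices with an odd number of coordinates
equal to `false` is bipartite: every directed closed walk whose vertices all have an odd
number of `false` coordinates has even length. -/
theorem odd_zeros_bipartite (m : ℕ) (hm : 1 ≤ m) (L : ℕ) (c : ℕ → Fin m → Bool)
    (harc : ∀ k < L, DStarArc (c k) (c (k + 1)))
    (hclosed : c L = c 0)
    (hodd : ∀ k ≤ L, Odd (Finset.univ.filter (fun i : Fin m => c k i = false)).card) :
    Even L := by
  have hwalk : ∀ k ≤ L, altZeros (c k) = (-1) ^ k * altZeros (c 0) := by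
    intro k hk
    induction k with
    | zero => simp
    | succ k ih => rw [(harc k hk).altZeros_eq_neg, ih (by omega)]; ring
  have hL := hwalk L le_rfl
  have h0 := altZeros_ne_zero (hodd 0 L.zero_le)
  by_contra hne
  rw [(Nat.not_even_iff_odd.mp hne).neg_one_pow, hclosed] at hL
  omega
end

section
/- For every m ≥ 2 and every binary word p ∈ V(D*_m): if p and the all-false word 0^m are mutually reachable in the transfer digraph D*_m, then the reversal of p (the word i ↦ p (m−1−i)) and 0^m are also mutually reachable in D*_m. (That is, the component R*_m of D*_m containing 0^m is closed under word reversal.) -/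
/-- Reflection of a letter in the horizontal axis, exchanging up and down. -/
def Alpha.flip : Alpha → Alpha
  | .a => .c
  | .b => .b
  | .c => .a
  | .d => .f
  | .e => .e
  | .f => .d

@[simp] theorem Alpha.right_flip (x : Alpha) : x.flip.right = x.right := by cases x <;> rfl

@[simp] theorem Alpha.left_flip (x : Alpha) : x.flip.left = x.left := by cases x <;> rfl

@[simp] theorem Alpha.down_flip (x : Alpha) : x.flip.down = x.up := by cases x <;> rfl

@[simp] theorem Alpha.up_flip (x : Alpha) : x.flip.up = x.down := by cases x <;> rfl

theorem InVD.flip_rev {m : ℕ} {w : Fin m → Alpha} (hw : InVD w) :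
    InVD fun i => (w i.rev).flip := by
  obtain ⟨hadj, hfirst, hlast⟩ := hw
  refine ⟨fun i j hij => ?_, fun i hi => ?_, fun i hi => ?_⟩
  · simpa using (hadj j.rev i.rev (by simp only [Fin.val_rev]; omega)).symm
  · simpa using hlast i.rev (by simp only [Fin.val_rev]; omega)
  · simpa using hfirst i.rev (by simp only [Fin.val_rev]; omega)

theorem DArc.flip_rev {m : ℕ} {v u : Fin m → Alpha} (h : DArc v u) :
    DArc (fun i => (v i.rev).flip) (fun i => (u i.rev).flip) :=
  ⟨h.1.flip_rev, h.2.1.flip_rev, fun i => by simpa using h.2.2 i.rev⟩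

theorem DStarArc.rev {m : ℕ} {p q : Fin m → Bool} (h : DStarArc p q) :
    DStarArc (fun i => p i.rev) (fun i => q i.rev) := by
  obtain ⟨v, u, rfl, rfl, h⟩ := h
  exact ⟨_, _, funext fun i => Alpha.right_flip _, funext fun i => Alpha.right_flip _, h.flip_rev⟩


/-- For `m ≥ 2`, the component of `D*_m` containing the all-false word `0^m` is closed
under word reversal: if a vertex `p` of `D*_m` and `0^m` are mutually reachable, then so
are the reversal of `p` and `0^m`. -/
theorem component_closed_under_reversal (m : ℕ) (hm : 2 ≤ m) (p : Fin m → Bool)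
    (hp : InVDStar p)
    (h1 : Relation.ReflTransGen DStarArc p (fun _ : Fin m => false))
    (h2 : Relation.ReflTransGen DStarArc (fun _ : Fin m => false) p) :
    Relation.ReflTransGen DStarArc (fun i : Fin m => p i.rev) (fun _ : Fin m => false) ∧
    Relation.ReflTransGen DStarArc (fun _ : Fin m => false) (fun i : Fin m => p i.rev) := by
  exact ⟨h1.lift (fun q (i : Fin m) => q i.rev) fun _ _ h => h.rev,
    h2.lift (fun q (i : Fin m) => q i.rev) fun _ _ h => h.rev⟩
end
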